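/- arXiv:1411.1766 — 6 statements merged into one kernel-verified Lean document; each statement's English description precedes it below -/
import Mathlib

section
/- Let n ≥ 1 and d ≥ 3 be integers with n(d−2) ≥ 2. Let x : ℕ^{2n+2} → ℂ be a function supported on I_{(n+1)d−(2n+2)} (i.e. x_i = 0 whenever i ∉ I_{(n+1)d−(2n+2)}), and let M(x) be the matrix with rows indexed by I_{nd−(2n+2)}, columns indexed by I_d, and (i,j)-entry x_{i+j}. If rank M(x) < binom(n+d, d) − (n+1)², then x_i = 0 for every i. -/
open Finset

/-- `I m d N` is the set of tuples `(i_0,…,i_{m-1}) ∈ ℕ^m` with `0 ≤ i_e ≤ d-2`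
for every `e` and `i_0 + ⋯ + i_{m-1} = N`. -/
def I (m d N : ℕ) : Finset (Fin m → ℕ) :=
  (Fintype.piFinset fun _ : Fin m => Finset.Iic (d - 2)).filter fun i => ∑ e, i e = N


/-- The polynomial `1 + X + ... + X^a`. -/
noncomputable def gP (a : ℕ) : Polynomial ℕ := ∑ i ∈ Finset.Iic a, Polynomial.X ^ i

theorem gP_coeff (a k : ℕ) : (gP a).coeff k = if k ≤ a then 1 else 0 := by
  simp [gP, Polynomial.finsetSum_coeff, Polynomial.coeff_X_pow]

theorem gP_zero : gP 0 = 1 := by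
  ext k
  rw [gP_coeff, Polynomial.coeff_one]
  simp [eq_comm]

theorem gP_mul_coeff (a b k : ℕ) :
    (gP a * gP b).coeff k = (Finset.Icc (k - b) (min a k)).card := by
  rw [Polynomial.coeff_mul, Finset.Nat.sum_antidiagonal_eq_sum_range_succ_mk]
  simp only [gP_coeff]
  rw [Finset.card_eq_sum_ones, ← Finset.sum_subset (s₁ := Finset.Icc (k - b) (min a k))]
  · apply Finset.sum_congr rfl
    intro i hi
    simp only [Finset.mem_Icc, le_min_iff] at hi
    rw [if_pos (by omega), if_pos (by omega), one_mul]
  · intro i hi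
    simp only [Finset.mem_Icc, le_min_iff, Finset.mem_range] at *
    omega
  · intro i hi hi2
    simp only [Finset.mem_Icc, le_min_iff, Finset.mem_range] at *
    by_cases h : i ≤ a
    · rw [if_neg (by omega : ¬ (k - i ≤ b))]; simp
    · rw [if_neg h]; simp

theorem gP_two (a b c e : ℕ) (h : a + b = c + e) (hac : a ≤ c) (hbc : b ≤ c) (k : ℕ) :
    (gP c * gP e).coeff k ≤ (gP a * gP b).coeff k := by
  rw [gP_mul_coeff, gP_mul_coeff, Nat.card_Icc, Nat.card_Icc]
  omega

theorem mul_coeff_mono (p q r : Polynomial ℕ) (h : ∀ k, p.coeff k ≤ q.coeff k) (k : ℕ) :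
    (r * p).coeff k ≤ (r * q).coeff k := by
  rw [Polynomial.coeff_mul, Polynomial.coeff_mul]
  exact Finset.sum_le_sum fun i _ => Nat.mul_le_mul_left _ (h _)

theorem gP_prod {ι : Type*} [DecidableEq ι] (D : ℕ) (hD : 0 < D) (a : ι → ℕ)
    (ha : ∀ e, a e ≤ D) (s : Finset ι) :
    ∃ q r, r < D ∧ ∑ e ∈ s, a e = q * D + r ∧
      ∀ k, (gP D ^ q * gP r).coeff k ≤ (∏ e ∈ s, gP (a e)).coeff k := by
  induction s using Finset.induction_on with
  | empty => exact ⟨0, 0, hD, by simp, by simp [gP_zero]⟩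
  | insert b s hb ih =>
    obtain ⟨q, r, hr, hsum, hle⟩ := ih
    have hab := ha b
    rw [Finset.sum_insert hb, Finset.prod_insert hb, hsum]
    by_cases hc : a b + r < D
    · refine ⟨q, a b + r, hc, by ring, fun k => ?_⟩
      refine le_trans ?_ (mul_coeff_mono _ _ _ hle k)
      have := mul_coeff_mono _ _ (gP D ^ q)
        (gP_two (a b) r (a b + r) 0 (by omega) (by omega) (by omega)) k
      rw [gP_zero, mul_one] at this
      rwa [mul_left_comm]
    · refine ⟨q + 1, a b + r - D, by omega, by rw [add_mul]; omega, fun k => ?_⟩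
      refine le_trans ?_ (mul_coeff_mono _ _ _ hle k)
      have := mul_coeff_mono _ _ (gP D ^ q)
        (gP_two (a b) r D (a b + r - D) (by omega) (by omega) (by omega)) k
      rw [mul_left_comm, pow_succ, mul_assoc]
      exact this

theorem gP_prod_coeff {ι : Type*} [DecidableEq ι] [Fintype ι] (a : ι → ℕ) (k : ℕ) :
    (∏ e, gP (a e)).coeff k =
      ((Fintype.piFinset fun e => Finset.Iic (a e)).filter fun j => ∑ e, j e = k).card := by
  unfold gP
  rw [Finset.prod_univ_sum, Polynomial.finsetSum_coeff, Finset.card_filter]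
  refine Finset.sum_congr rfl fun j _ => ?_
  rw [Finset.prod_pow_eq_pow_sum, Polynomial.coeff_X_pow]
  simp [eq_comm]

theorem count_top (n D : ℕ) :
    (n + (D + 2)).choose (D + 2) ≤ (gP D ^ (n + 1)).coeff (D + 2) + (n + 1) ^ 2 := by
  classical
  have h0 : (gP D ^ (n + 1)) = ∏ _e : Fin (n + 1), gP D := by simp
  rw [h0, gP_prod_coeff]
  have h1 := Finset.card_finsuppAntidiag_nat_eq_choose (s := (Finset.univ : Finset (Fin (n + 1)))) (D + 2)
  rw [Finset.card_univ, Fintype.card_fin, show n + 1 + (D + 2) - 1 = n + (D + 2) by omega] at h1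
  rw [← h1]
  set T := (Finset.univ : Finset (Fin (n + 1))).finsuppAntidiag (D + 2) with hT
  let B : Finset (Fin (n + 1) →₀ ℕ) :=
    (Finset.univ : Finset (Fin (n + 1) × Fin (n + 1))).image
      fun p => Finsupp.single p.1 (D + 1) + Finsupp.single p.2 1
  have hB : B.card ≤ (n + 1) ^ 2 := by
    refine Finset.card_image_le.trans ?_
    simp [sq]
  have hsub : T ⊆ (T.filter fun f => ∀ e, f e ≤ D) ∪ B := by
    intro f hf
    by_cases hc : ∀ e, f e ≤ D
    · exact Finset.mem_union_left _ (Finset.mem_filter.2 ⟨hf, hc⟩)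
    · push Not at hc
      obtain ⟨e, he⟩ := hc
      apply Finset.mem_union_right
      have hle : Finsupp.single e (D + 1) ≤ f := by
        rw [Finsupp.single_le_iff]; exact he
      obtain ⟨g, rfl⟩ := exists_add_of_le hle
      have hs : (Finsupp.single e (D + 1) + g).sum (fun _ n => n) = D + 2 := by
        rw [hT, Finset.mem_finsuppAntidiag] at hf
        rw [Finsupp.sum_fintype _ _ (by simp)]
        exact hf.1
      rw [Finsupp.sum_add_index' (by simp) (by simp), Finsupp.sum_single_index rfl] at hs
      obtain ⟨b, rfl⟩ := (Finsupp.sum_eq_one_iff g).1 (by omega)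
      exact Finset.mem_image.2 ⟨(e, b), Finset.mem_univ _, rfl⟩
  refine (Finset.card_le_card hsub).trans ((Finset.card_union_le _ _).trans (add_le_add ?_ hB))
  refine Finset.card_le_card_of_injOn (fun f => (f : Fin (n + 1) → ℕ)) ?_ ?_
  · intro f hf
    simp only [Finset.coe_filter, Set.mem_ofPred_eq, hT, Finset.mem_finsuppAntidiag,
      Fintype.mem_piFinset, Finset.mem_Iic] at hf ⊢
    exact ⟨hf.2, hf.1.1⟩
  · intro f _ g _ h
    exact DFunLike.coe_injective h

theorem count_lower (n D : ℕ) (hD : 0 < D) (a : Fin (2 * n + 2) → ℕ) (ha : ∀ e, a e ≤ D)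
    (hs : ∑ e, a e = (n + 1) * D) :
    (n + (D + 2)).choose (D + 2) - (n + 1) ^ 2 ≤
      ((Fintype.piFinset fun e => Finset.Iic (a e)).filter fun j => ∑ e, j e = D + 2).card := by
  rw [← gP_prod_coeff]
  obtain ⟨q, r, hr, hsum, hle⟩ := gP_prod D hD a ha Finset.univ
  rw [hs] at hsum
  have hr0 : r = 0 := by
    have := congrArg (· % D) hsum
    simp only [Nat.mul_mod_left, Nat.mul_add_mod_self_right, Nat.mod_eq_of_lt hr] at this
    exact this.symm
  subst hr0
  have hq : q = n + 1 := (Nat.eq_of_mul_eq_mul_right hD hsum).symm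
  subst hq
  have h1 := hle (D + 2)
  rw [gP_zero, mul_one] at h1
  have := count_top n D
  omega

theorem rank_lower {m : ℕ} (x : (Fin m → ℕ) → ℂ) (a : Fin m → ℕ) (hxa : x a ≠ 0)
    (hmin : ∀ b, toLex b < toLex a → x b = 0) {R C : Finset (Fin m → ℕ)}
    (T : Finset (Lex (Fin m → ℕ))) (hT : ∀ j ∈ T, ofLex j ≤ a)
    (hC : ∀ j ∈ T, ofLex j ∈ C) (hR : ∀ j ∈ T, a - ofLex j ∈ R) :
    T.card ≤ (Matrix.of fun (i : R) (j : C) => x (i.1 + j.1)).rank := by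
  set M := (Matrix.of fun (i : R) (j : C) => x (i.1 + j.1)) with hM
  let r : T → R := fun j => ⟨a - ofLex j.1, hR j.1 j.2⟩
  let c : T → C := fun j => ⟨ofLex j.1, hC j.1 j.2⟩
  have hent : ∀ i j : T, M.submatrix r c i j = x (a - ofLex i.1 + ofLex j.1) := fun i j => rfl
  have hdiag : ∀ i : T, M.submatrix r c i i = x a := by
    intro i
    rw [hent, tsub_add_cancel_of_le (hT i.1 i.2)]
  have htri : (M.submatrix r c).BlockTriangular id := by
    intro i j hij
    rw [hent]
    apply hmin
    have h1 : (j.1 : Lex (Fin m → ℕ)) < i.1 := hij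
    have h2 : toLex (a - ofLex i.1) + j.1 < toLex (a - ofLex i.1) + i.1 := by gcongr
    have h3 : toLex (a - ofLex i.1) + i.1 = toLex a :=
      congrArg toLex (tsub_add_cancel_of_le (hT i.1 i.2))
    rw [h3] at h2
    exact h2
  have hdet : IsUnit (M.submatrix r c) := by
    rw [Matrix.isUnit_iff_isUnit_det, Matrix.det_of_upperTriangular htri, isUnit_iff_ne_zero]
    simp only [hdiag]
    exact Finset.prod_ne_zero_iff.2 fun _ _ => hxa
  have := Matrix.rank_submatrix_le M r c
  rw [Matrix.rank_of_isUnit _ hdet] at this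
  simpa using this

theorem mem_I {m d N : ℕ} {i : Fin m → ℕ} : i ∈ I m d N ↔ (∀ e, i e ≤ d - 2) ∧ ∑ e, i e = N := by
  simp [I]

theorem stmt0 (n d : ℕ) (hn : 1 ≤ n) (hd : 3 ≤ d) (hnd : 2 ≤ n * (d - 2))
    (x : (Fin (2 * n + 2) → ℕ) → ℂ)
    (hsupp : ∀ i, i ∉ I (2 * n + 2) d ((n + 1) * d - (2 * n + 2)) → x i = 0)
    (hrank : (Matrix.of fun (i : I (2 * n + 2) d (n * d - (2 * n + 2)))
        (j : I (2 * n + 2) d d) => x (i.1 + j.1)).rank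
      < Nat.choose (n + d) d - (n + 1) ^ 2) :
    ∀ i, x i = 0 := by
  classical
  by_contra hne
  push Not at hne
  obtain ⟨i0, hi0⟩ := hne
  obtain ⟨D, rfl⟩ : ∃ D, d = D + 2 := ⟨d - 2, by omega⟩
  have e1 : (n + 1) * (D + 2) - (2 * n + 2) = (n + 1) * D := by
    rw [show (n + 1) * (D + 2) = (n + 1) * D + (2 * n + 2) by ring]; omega
  have e2 : n * (D + 2) - (2 * n + 2) = n * D - 2 := by
    rw [show n * (D + 2) = n * D + 2 * n by ring]; omega
  rw [e1] at hsupp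
  rw [Nat.add_sub_cancel] at hnd
  have hmem : ∀ i, x i ≠ 0 → i ∈ I (2 * n + 2) (D + 2) ((n + 1) * D) := fun i h => by
    by_contra hc; exact h (hsupp i hc)
  obtain ⟨a, haS, hamin⟩ := Finset.exists_min_image
    ((I (2 * n + 2) (D + 2) ((n + 1) * D)).filter fun i => x i ≠ 0) toLex
    ⟨i0, Finset.mem_filter.2 ⟨hmem i0 hi0, hi0⟩⟩
  obtain ⟨haI, hxa⟩ := Finset.mem_filter.1 haS
  obtain ⟨haD, has⟩ := mem_I.1 haI
  rw [Nat.add_sub_cancel] at haD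
  have hcount := count_lower n D (by omega) a haD has
  set T := (Fintype.piFinset fun e => Finset.Iic (a e)).filter fun j => ∑ e, j e = D + 2 with hTdef
  have hTm : ∀ j ∈ T, (∀ e, j e ≤ a e) ∧ ∑ e, j e = D + 2 := by
    intro j hj
    simpa [hTdef] using hj
  have key := rank_lower x a hxa (R := I (2 * n + 2) (D + 2) (n * (D + 2) - (2 * n + 2)))
    (C := I (2 * n + 2) (D + 2) (D + 2)) (fun b hb => by
      by_contra hc
      exact absurd (hamin b (Finset.mem_filter.2 ⟨hmem b hc, hc⟩)) (not_le.2 hb))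
    (T.map toLex.toEmbedding)
    (fun j hj0 => by
      obtain ⟨j, hj, rfl⟩ := Finset.mem_map.1 hj0
      exact (hTm j hj).1)
    (fun j hj0 => by
      obtain ⟨j, hj, rfl⟩ := Finset.mem_map.1 hj0
      exact mem_I.2 ⟨fun e => ((hTm j hj).1 e).trans (haD e), (hTm j hj).2⟩)
    (fun j hj0 => by
      obtain ⟨j, hj, rfl⟩ := Finset.mem_map.1 hj0
      refine mem_I.2 ⟨fun e => (Nat.sub_le _ _).trans (haD e), ?_⟩
      have h1 : ∑ e, (a - j) e + ∑ e, j e = ∑ e, a e := by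
        rw [← Finset.sum_add_distrib]
        exact Finset.sum_congr rfl fun e _ => Nat.sub_add_cancel ((hTm j hj).1 e)
      rw [(hTm j hj).2, has, add_mul] at h1
      rw [e2]
      change ∑ e, (a - j) e = _
      omega)
  rw [Finset.card_map] at key
  omega
end

section
/- Let n ≥ 1 and d ≥ 3 be integers with n(d−2) ≥ 2. For every k ∈ I_{(n+1)d−(2n+2)}, the number of pairs (i,j) ∈ I_{nd−(2n+2)} × I_d with i + j = k is at least binom(n+d, d) − (n+1)². -/
open Finset

open Polynomial in
noncomputable def gp (m : ℕ) : Polynomial ℕ := ∑ i ∈ range m, X ^ i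

open Polynomial in
lemma gp_add (a b : ℕ) : gp (a + b) = gp a + X ^ a * gp b := by
  simp only [gp, Finset.sum_range_add, Finset.mul_sum, pow_add]

open Polynomial in
lemma gp_mul (x y t : ℕ) (h : y ≤ x) :
    ∃ q : Polynomial ℕ, gp x * gp (y + t) = gp (x + t) * gp y + q := by
  obtain ⟨z, rfl⟩ := Nat.exists_eq_add_of_le h
  refine ⟨gp t * X ^ y * gp z, ?_⟩
  rw [gp_add y t, gp_add (y + z) t, pow_add]
  have h2 : gp (y + z) = gp z + X ^ z * gp y := by rw [add_comm, gp_add]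
  have : gp (y + z) * (gp y + X ^ y * gp t)
      = gp (y + z) * gp y + gp (y + z) * (X ^ y * gp t) := by ring
  rw [this]
  nth_rewrite 2 [h2]
  ring

lemma gp_prod {ι : Type*} (D : ℕ) (hD : 1 ≤ D) (k : ι → ℕ) (s : Finset ι)
    (hk : ∀ e, k e ≤ D) :
    ∃ (q r : ℕ) (h : Polynomial ℕ), r < D ∧ ∑ e ∈ s, k e = q * D + r ∧
      ∏ e ∈ s, gp (k e + 1) = gp (D + 1) ^ q * gp (r + 1) + h := by
  classical
  induction s using Finset.induction_on with
  | empty => exact ⟨0, 0, 0, by omega, by simp, by simp [gp]⟩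
  | insert a s ha ih =>
    obtain ⟨q, r, h, hr, hs, hp⟩ := ih
    rw [Finset.sum_insert ha, Finset.prod_insert ha, hs, hp]
    have hka := hk a
    by_cases hc : k a + r < D
    · obtain ⟨w, hw⟩ := gp_mul (r + 1) 1 (k a) (by omega)
      refine ⟨q, k a + r, gp (k a + 1) * h + gp (D + 1) ^ q * w, hc, by ring, ?_⟩
      have e1 : gp 1 = 1 := by simp [gp]
      rw [e1, mul_one, add_comm 1 (k a)] at hw
      rw [show k a + r + 1 = r + 1 + k a by ring]
      calc _ = gp (D + 1) ^ q * (gp (r + 1) * gp (k a + 1)) + gp (k a + 1) * h := by ring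
        _ = _ := by rw [hw]; ring
    · obtain ⟨w, hw⟩ := gp_mul (r + 1) (k a + r - D + 1) (D - r) (by omega)
      refine ⟨q + 1, k a + r - D, gp (k a + 1) * h + gp (D + 1) ^ q * w, by omega, ?_, ?_⟩
      · rw [add_mul]; omega
      rw [show k a + r - D + 1 + (D - r) = k a + 1 by omega,
        show r + 1 + (D - r) = D + 1 by omega] at hw
      calc _ = gp (D + 1) ^ q * (gp (r + 1) * gp (k a + 1)) + gp (k a + 1) * h := by ring
        _ = _ := by rw [hw]; ring

lemma gp_coeff {m : ℕ} (k : Fin m → ℕ) (N : ℕ) :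
    (∏ e, gp (k e + 1)).coeff N =
      ((Fintype.piFinset fun e => range (k e + 1)).filter fun j => ∑ e, j e = N).card := by
  unfold gp
  rw [Finset.prod_univ_sum, Polynomial.finsetSum_coeff, Finset.card_filter]
  refine Finset.sum_congr rfl fun p _ => ?_
  rw [Finset.prod_pow_eq_pow_sum, Polynomial.coeff_X_pow]
  simp [eq_comm]

lemma count_low (n D : ℕ) (hD : 1 ≤ D) :
    Nat.choose (n + (D + 2)) (D + 2) - (n + 1) ^ 2 ≤
     ((Fintype.piFinset fun _ : Fin (n + 1) => range (D + 1)).filter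
        fun j => ∑ e, j e = D + 2).card := by
  set A := (Fintype.piFinset fun _ : Fin (n + 1) => range (D + 1)).filter
        fun j => ∑ e, j e = D + 2 with hA
  let B : Finset (Fin (n + 1) → ℕ) := (univ : Finset (Fin (n + 1) × Fin (n + 1))).image
    fun p => Pi.single p.1 (D + 1) + Pi.single p.2 1
  have hB : B.card ≤ (n + 1) ^ 2 := by
    refine Finset.card_image_le.trans ?_
    simp [sq]
  have hsub : Finset.piAntidiag (univ : Finset (Fin (n + 1))) (D + 2) ⊆ A ∪ B := by
    intro j hj
    rw [Finset.mem_piAntidiag] at hj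
    rw [Finset.mem_union]
    by_cases hb : ∀ e, j e ≤ D
    · left
      simp only [hA, Finset.mem_filter, Fintype.mem_piFinset, Finset.mem_range]
      exact ⟨fun e => Nat.lt_succ_of_le (hb e), hj.1⟩
    · right
      push Not at hb
      obtain ⟨e, he⟩ := hb
      have hle : Pi.single e (D + 1) ≤ j := by
        intro x
        by_cases hx : x = e
        · subst hx; simpa using he
        · simp [hx]
      obtain ⟨l, hl⟩ := exists_add_of_le hle
      have hsum : ∑ x, l x = 1 := by
        have := hj.1
        rw [hl] at this
        simp only [Pi.add_apply, Finset.sum_add_distrib, Finset.sum_pi_single', Finset.mem_univ,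
          if_true, Finset.sum_pi_single] at this
        omega
      have : ∃ f, l f ≠ 0 := by
        by_contra hcon
        push Not at hcon
        simp [hcon] at hsum
      obtain ⟨f, hf⟩ := this
      have hlf : l = Pi.single f 1 := by
        have h1 := Finset.add_sum_erase univ l (Finset.mem_univ f)
        have h0 : ∑ x ∈ univ.erase f, l x = 0 := by omega
        rw [Finset.sum_eq_zero_iff] at h0
        funext x
        by_cases hx : x = f
        · subst hx; simp; omega
        · simp [hx]; exact h0 x (by simp [hx])
      simp only [B, Finset.mem_image]
      exact ⟨(e, f), Finset.mem_univ _, by rw [hl, hlf]⟩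
  have h1 := (Finset.card_le_card hsub).trans (Finset.card_union_le _ _)
  have h2 : (Finset.piAntidiag (univ : Finset (Fin (n + 1))) (D + 2)).card
      = Nat.choose (n + (D + 2)) (D + 2) := by
    letI : Fintype {P : Fin (n + 1) → ℕ // ∑ i, P i = D + 2} :=
      Fintype.ofEquiv _ (Sym.equivNatSumOfFintype (Fin (n + 1)) (D + 2))
    have e := Fintype.card_congr (Sym.equivNatSumOfFintype (Fin (n + 1)) (D + 2))
    rw [Sym.card_sym_eq_choose, Fintype.card_fin,
      show n + 1 + (D + 2) - 1 = n + (D + 2) by omega] at e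
    rw [e]
    symm
    apply Fintype.card_of_subtype
    intro x
    simp
  omega

theorem stmt1 (n d : ℕ) (hn : 1 ≤ n) (hd : 3 ≤ d) (hnd : 2 ≤ n * (d - 2))
    (k : Fin (2 * n + 2) → ℕ) (hk : k ∈ I (2 * n + 2) d ((n + 1) * d - (2 * n + 2))) :
    Nat.choose (n + d) d - (n + 1) ^ 2 ≤
      (((I (2 * n + 2) d (n * d - (2 * n + 2))) ×ˢ (I (2 * n + 2) d d)).filter
        fun p => p.1 + p.2 = k).card := by
  obtain ⟨D, rfl⟩ : ∃ D, d = D + 2 := ⟨d - 2, by omega⟩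
  have e1 : (n + 1) * (D + 2) - (2 * n + 2) = (n + 1) * D := by
    rw [show (n + 1) * (D + 2) = (n + 1) * D + (2 * n + 2) by ring]; omega
  have e2 : n * (D + 2) - (2 * n + 2) = n * D - 2 := by
    rw [show n * (D + 2) = n * D + 2 * n by ring]; omega
  simp only [Nat.add_sub_cancel] at hnd
  rw [e1] at hk
  rw [e2]
  simp only [I, Finset.mem_filter, Fintype.mem_piFinset, Finset.mem_Iic, Nat.add_sub_cancel] at hk
  obtain ⟨hk1, hk2⟩ := hk
  have hD : 1 ≤ D := by omega
  obtain ⟨q, r, h, hr, hs, hp⟩ := gp_prod D hD k univ hk1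
  rw [hk2] at hs
  have hq : q = n + 1 := by
    have := congrArg (· / D) hs
    simp only [Nat.mul_div_cancel _ hD] at this
    rw [mul_comm q D, Nat.mul_add_div hD, Nat.div_eq_of_lt hr] at this
    omega
  subst hq
  have hr0 : r = 0 := by omega
  subst hr0
  have g1 : gp (0 + 1) = 1 := by simp [gp]
  rw [g1, mul_one] at hp
  have hc := congrArg (fun p => p.coeff (D + 2)) hp
  have hc2 := gp_coeff (fun _ : Fin (n + 1) => D) (D + 2)
  rw [Finset.prod_const, Finset.card_univ, Fintype.card_fin] at hc2
  simp only [Polynomial.coeff_add] at hc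
  rw [gp_coeff, hc2] at hc
  have hlow := count_low n D hD
  refine (hlow.trans (Nat.le_of_add_right_le hc.ge)).trans ?_
  refine Finset.card_le_card_of_injOn (fun j => (k - j, j)) ?_ ?_
  · intro j hj
    simp only [Finset.coe_filter, Fintype.mem_piFinset, Finset.mem_range, Set.mem_ofPred_eq] at hj
    obtain ⟨hj1, hj2⟩ := hj
    have hjk : ∀ e, j e ≤ k e := fun e => Nat.le_of_lt_succ (hj1 e)
    have hadd : k - j + j = k := by
      funext e; simp [Nat.sub_add_cancel (hjk e)]
    have hsum : ∑ e, (k - j) e + ∑ e, j e = (n + 1) * D := by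
      rw [← hk2, ← Finset.sum_add_distrib]
      exact Finset.sum_congr rfl fun e _ => congrFun hadd e
    simp only [I, Finset.coe_filter, Finset.mem_product, Finset.mem_filter, Fintype.mem_piFinset,
      Finset.mem_Iic, Set.mem_ofPred_eq, Nat.add_sub_cancel]
    refine ⟨⟨⟨fun e => (Nat.sub_le _ _).trans (hk1 e), ?_⟩,
      fun e => (hjk e).trans (hk1 e), hj2⟩, hadd⟩
    rw [add_mul] at hsum
    omega
  · intro a _ b _ hab
    exact (Prod.ext_iff.1 hab).2
end

section
/- Let n ≥ 1 and d ≥ 3 be integers with n(d−2) ≥ 2. If k ∈ ℕ^{2n+2} has exactly n+1 coordinates equal to 0 and its remaining n+1 coordinates equal to d−2, then the number of pairs (i,j) ∈ I_{nd−(2n+2)} × I_d with i + j = k is exactly binom(n+d, d) − (n+1)². -/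
open Finset

lemma good_card {m : ℕ} (S : Finset (Fin m)) (d : ℕ) (hd : 3 ≤ d) (T : ℕ)
    (hT : (S.piAntidiag d).card = T) :
    ((S.piAntidiag d).filter fun j => ∀ e, j e ≤ d - 2).card = T - S.card ^ 2 := by
  have hbad : ((S.piAntidiag d).filter fun j => ¬ ∀ e, j e ≤ d - 2).card = S.card ^ 2 := by
    rw [sq, ← card_product]
    symm
    have key : ∀ a b c : Fin m, (Pi.single a (d-1) + Pi.single b 1 : Fin m → ℕ) c
        = (if c = a then d - 1 else 0) + (if c = b then 1 else 0) := by
      intro a b c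
      simp [Pi.single_apply]
    refine card_bij (fun p _ => (Pi.single p.1 (d-1) + Pi.single p.2 1 : Fin m → ℕ)) ?_ ?_ ?_
    · rintro ⟨a, b⟩ hab
      simp only [mem_product] at hab
      simp only [mem_filter, mem_piAntidiag, key]
      refine ⟨⟨?_, ?_⟩, ?_⟩
      · rw [sum_add_distrib, sum_ite_eq', sum_ite_eq', if_pos hab.1, if_pos hab.2]; omega
      · intro i hi
        by_cases h1 : i = a
        · subst h1; exact hab.1
        · by_cases h2 : i = b
          · subst h2; exact hab.2
          · simp [h1, h2] at hi
      · intro h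
        have := h a
        simp at this
        omega
    · rintro ⟨a, b⟩ - ⟨a', b'⟩ - h
      have h1 := congrFun h a
      have h2 := congrFun h b
      simp only [key] at h1 h2
      have ha : a = a' := by
        by_contra hne
        simp only [if_neg hne, if_true] at h1
        split_ifs at h1 <;> omega
      subst ha
      have hb : b = b' := by
        by_contra hne
        simp [if_neg hne] at h2
      rw [hb]
    · intro j hj
      simp only [mem_filter, mem_piAntidiag, not_forall, not_le] at hj
      obtain ⟨⟨hs, hsup⟩, a, ha⟩ := hj
      have haS : a ∈ S := hsup a (by omega)
      have hsum : j a + ∑ e ∈ S.erase a, j e = d := by rw [add_sum_erase _ _ haS, hs]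
      by_cases hda : j a = d
      · refine ⟨(a, a), by simp [haS], ?_⟩
        funext c
        rw [key]
        by_cases hc : c = a
        · subst hc; simp; omega
        · simp only [if_neg hc]
          by_contra hne
          have hcS := hsup c (by omega)
          have := single_le_sum (f := j) (fun _ _ => Nat.zero_le _) (mem_erase.2 ⟨hc, hcS⟩)
          omega
      · have h1 : ∑ e ∈ S.erase a, j e = 1 := by omega
        obtain ⟨b, hb, hb0⟩ : ∃ b ∈ S.erase a, j b ≠ 0 := by
          by_contra! hcon
          rw [sum_eq_zero hcon] at h1
          omega
        have h2 := add_sum_erase _ j hb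
        have hba := (mem_erase.1 hb).1
        refine ⟨(a, b), by simp [haS, (mem_erase.1 hb).2], ?_⟩
        funext c
        rw [key]
        by_cases hc : c = a
        · subst hc; simp [hba.symm]; omega
        · by_cases hcb : c = b
          · subst hcb; simp [hc]; omega
          · simp only [if_neg hc, if_neg hcb]
            by_contra hne
            have hcS := hsup c (by omega)
            have := single_le_sum (f := j) (fun _ _ => Nat.zero_le _)
              (mem_erase.2 ⟨hcb, mem_erase.2 ⟨hc, hcS⟩⟩)
            omega
  have := card_filter_add_card_filter_not (s := S.piAntidiag d) (fun j => ∀ e, j e ≤ d - 2)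
  omega

theorem stmt3 (n d : ℕ) (hn : 1 ≤ n) (hd : 3 ≤ d) (hnd : 2 ≤ n * (d - 2))
    (k : Fin (2 * n + 2) → ℕ)
    (hzeros : (Finset.univ.filter fun e => k e = 0).card = n + 1)
    (hrest : ∀ e, k e ≠ 0 → k e = d - 2) :
    (((I (2 * n + 2) d (n * d - (2 * n + 2))) ×ˢ (I (2 * n + 2) d d)).filter
        fun p => p.1 + p.2 = k).card
      = Nat.choose (n + d) d - (n + 1) ^ 2 := by
  have hS : (Finset.univ.filter fun e => ¬ k e = 0).card = n + 1 := by
    have := card_filter_add_card_filter_not (s := univ) (fun e => k e = 0)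
    rw [hzeros, card_univ, Fintype.card_fin] at this
    omega
  have hk : ∀ e, k e ≤ d - 2 := by
    intro e
    by_cases h : k e = 0
    · omega
    · exact (hrest e h).le
  have hksum : ∑ e, k e = (n + 1) * (d - 2) := by
    rw [← sum_filter_ne_zero, sum_congr rfl (g := fun _ => d - 2), sum_const, hS, smul_eq_mul]
    intro e he
    exact hrest e (mem_filter.1 he).2
  have hN : n * d - (2 * n + 2) + d = (n + 1) * (d - 2) := by
    obtain ⟨c, rfl⟩ := Nat.exists_eq_add_of_le hd
    have e1 : 3 + c - 2 = c + 1 := by omega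
    rw [e1] at hnd ⊢
    have e2 : n * (3 + c) = n * (c + 1) + 2 * n := by ring
    have e3 : (n + 1) * (c + 1) = n * (c + 1) + c + 1 := by ring
    rw [e2, e3]
    omega
  rw [← hS, ← good_card _ d hd _ (T := Nat.choose (n + d) d)]
  · refine card_nbij' (fun p => p.2) (fun j => (k - j, j)) ?_ ?_ ?_ ?_
    · rintro ⟨i, j⟩ h
      simp only [coe_filter, Set.mem_ofPred_eq, mem_product, I, mem_filter, Fintype.mem_piFinset,
        mem_Iic] at h
      obtain ⟨⟨⟨h1, h2⟩, h3, h4⟩, h5⟩ := h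
      have hj : ∀ e, j e ≠ 0 → k e ≠ 0 := by
        intro e he
        rw [← h5, Pi.add_apply]; omega
      simp only [coe_filter, Set.mem_ofPred_eq, mem_piAntidiag, mem_filter, mem_univ, true_and]
      refine ⟨⟨?_, hj⟩, h3⟩
      rw [← h4]
      apply sum_subset (subset_univ _)
      intro x _ hx
      by_contra hne
      exact hx (by simpa using hj x hne)
    · intro j h
      simp only [coe_filter, Set.mem_ofPred_eq, mem_piAntidiag, mem_filter, mem_univ,
        true_and] at h
      obtain ⟨⟨h1, h2⟩, h3⟩ := h
      have hjk : ∀ e, j e ≤ k e := by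
        intro e
        by_cases he : j e = 0
        · omega
        · rw [hrest e (h2 e he)]; exact h3 e
      have hadd : k - j + j = k := by
        funext e
        have := hjk e
        simp only [Pi.add_apply, Pi.sub_apply]; omega
      have hjs : ∑ e, j e = d := by
        rw [← h1]
        symm
        apply sum_subset (subset_univ _)
        intro x _ hx
        by_contra hne
        exact hx (by simpa using h2 x hne)
      simp only [coe_filter, Set.mem_ofPred_eq, mem_product, I, mem_filter, Fintype.mem_piFinset,
        mem_Iic]
      refine ⟨⟨⟨?_, ?_⟩, h3, hjs⟩, hadd⟩
      · intro e
        have := hk e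
        simp only [Pi.sub_apply]; omega
      · have h6 : ∑ e, (k - j) e + ∑ e, j e = ∑ e, k e := by
          rw [← sum_add_distrib]
          conv_rhs => rw [← hadd]
          rfl
        omega
    · rintro ⟨i, j⟩ h
      have h5 := (mem_filter.1 h).2
      simp only at h5
      simp [← h5]
    · intro j h
      rfl
  · have h7 := card_finsuppAntidiag_nat_eq_choose (s := univ.filter fun e => ¬ k e = 0) d
    rw [hS] at h7
    have e1 : n + 1 + d - 1 = n + d := by omega
    rw [e1] at h7
    rw [← h7, finsuppAntidiag, card_map, card_attach]
end

section
/- Let n ≥ 1 and d ≥ 3 be integers with n(d−2) ≥ 2. There exists a function x : ℕ^{2n+2} → ℂ, supported on I_{(n+1)d−(2n+2)} and not identically zero, such that the matrix M(x) with rows indexed by I_{nd−(2n+2)}, columns indexed by I_d, and (i,j)-entry x_{i+j} has rank exactly binom(n+d, d) − (n+1)². -/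
open Finset

theorem aux_rank {R C B : Type*} [Fintype R] [Fintype C] [Fintype B] [DecidableEq B]
    [DecidableEq R] [DecidableEq C]
    (M : Matrix R C ℂ) (P : Matrix R B ℂ) (Q : Matrix B C ℂ) (hM : M = P * Q)
    (r : B → R) (c : B → C) (h : ∀ b b', M (r b) (c b') = if b = b' then 1 else 0) :
    M.rank = Fintype.card B := by
  apply le_antisymm
  · rw [hM]
    exact (Matrix.rank_mul_le_left _ _).trans (Matrix.rank_le_card_width _)
  · have h1 : (1 : Matrix B B ℂ) = (Matrix.of fun b i => if i = r b then (1:ℂ) else 0) *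
        (M * (Matrix.of fun j b => if j = c b then (1:ℂ) else 0)) := by
      ext b b'
      simp [Matrix.mul_apply, h, Matrix.one_apply]
    calc Fintype.card B = (1 : Matrix B B ℂ).rank := by rw [Matrix.rank_one]
      _ ≤ _ := by
        rw [h1]
        exact (Matrix.rank_mul_le_right _ _).trans (Matrix.rank_mul_le_left _ _)

theorem aux_mem (m d N : ℕ) (i : Fin m → ℕ) : i ∈ I m d N ↔ (∀ e, i e ≤ d - 2) ∧ ∑ e, i e = N := by
  simp [I]

theorem aux_card (n d : ℕ) (hd : 3 ≤ d) :
    (I (n + 1) d d).card = Nat.choose (n + d) d - (n + 1) ^ 2 := by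
  have h0 : (Finset.piAntidiag (Finset.univ : Finset (Fin (n+1))) d).card = (n + d).choose d := by
    have e := Sym.equivNatSumOfFintype (Fin (n+1)) d
    have h := Finset.card_eq_of_equiv_fintype
      (s := Finset.piAntidiag (Finset.univ : Finset (Fin (n+1))) d)
      ((Equiv.subtypeEquivRight (by intro b; simp)).trans e.symm)
    rw [h, Sym.card_sym_eq_choose, Fintype.card_fin]
    congr 1
    omega
  have hsub : I (n + 1) d d ⊆ Finset.piAntidiag Finset.univ d := by
    intro b hb
    rw [aux_mem] at hb
    simp [hb.2]
  have h1 : (Finset.piAntidiag Finset.univ d \ I (n + 1) d d).card = (n + 1) ^ 2 := by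
    have : Finset.piAntidiag Finset.univ d \ I (n + 1) d d =
        (Finset.univ : Finset (Fin (n+1) × Fin (n+1))).image
          (fun p => (Pi.single p.1 (d-1) + Pi.single p.2 1 : Fin (n+1) → ℕ)) := by
      ext b
      simp only [Finset.mem_sdiff, aux_mem, Finset.mem_image, Finset.mem_univ, true_and,
        Finset.mem_piAntidiag, Prod.exists]
      constructor
      · rintro ⟨⟨hs, -⟩, h⟩
        have : ∃ e, d - 1 ≤ b e := by
          by_contra! hc
          exact h ⟨fun e => by have := hc e; omega, hs⟩
        obtain ⟨e, he⟩ := this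
        have hb : b = Pi.single e (d-1) + (b - Pi.single e (d-1)) := by
          ext f
          by_cases hf : f = e
          · subst hf; simp; omega
          · simp [hf]
        have hs' : ∑ f, (b - (Pi.single e (d-1) : Fin (n+1) → ℕ)) f = 1 := by
          have h3 := hs
          rw [hb] at h3
          simp only [Pi.add_apply, Finset.sum_add_distrib] at h3
          have h4 : ∑ f, (Pi.single e (d-1) : Fin (n+1) → ℕ) f = d - 1 := by simp
          rw [h4] at h3
          omega
        obtain ⟨f, hf, hf'⟩ : ∃ f, (b - (Pi.single e (d-1) : Fin (n+1) → ℕ)) f = 1 ∧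
            ∀ g ≠ f, (b - (Pi.single e (d-1) : Fin (n+1) → ℕ)) g = 0 := by
          generalize b - (Pi.single e (d-1) : Fin (n+1) → ℕ) = g at hs'
          obtain ⟨f, -, hf⟩ := Finset.exists_ne_zero_of_sum_ne_zero (by rw [hs']; exact one_ne_zero)
          have h5 := Finset.add_sum_erase Finset.univ g (Finset.mem_univ f)
          rw [hs'] at h5
          refine ⟨f, by omega, fun k hk => ?_⟩
          have h6 := Finset.single_le_sum (f := g) (fun _ _ => Nat.zero_le _)
            (Finset.mem_erase.2 ⟨hk, Finset.mem_univ k⟩)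
          omega
        refine ⟨e, f, ?_⟩
        rw [hb]
        congr 1
        ext g
        by_cases hg : g = f
        · subst hg; rw [hf]; simp
        · rw [hf' g hg]; simp [hg]
      · rintro ⟨e, f, rfl⟩
        refine ⟨⟨?_, by simp⟩, ?_⟩
        · simp [Finset.sum_add_distrib]; omega
        · rintro ⟨h, -⟩
          have := h e
          simp at this
          omega
    rw [this, Finset.card_image_of_injective]
    · simp [sq]
    · rintro ⟨e, f⟩ ⟨e', f'⟩ h
      simp only at h
      have he : e = e' := by
        by_contra hne
        have := congrFun h e
        simp [hne, Pi.single_apply] at this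
        split_ifs at this <;> omega
      subst he
      have h2 := add_left_cancel h
      have := congrFun h2 f
      simp [Pi.single_apply] at this
      simp [this]
  rw [Finset.card_sdiff_of_subset hsub, h0] at h1
  have := Finset.card_le_card hsub
  omega

theorem stmt4 (n d : ℕ) (hn : 1 ≤ n) (hd : 3 ≤ d) (hnd : 2 ≤ n * (d - 2)) :
    ∃ x : (Fin (2 * n + 2) → ℕ) → ℂ,
      (∀ i, i ∉ I (2 * n + 2) d ((n + 1) * d - (2 * n + 2)) → x i = 0) ∧
      (∃ i, x i ≠ 0) ∧
      (Matrix.of fun (i : I (2 * n + 2) d (n * d - (2 * n + 2)))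
          (j : I (2 * n + 2) d d) => x (i.1 + j.1)).rank
        = Nat.choose (n + d) d - (n + 1) ^ 2 := by
  obtain ⟨c, rfl⟩ : ∃ c, d = c + 2 := ⟨d - 2, by omega⟩
  have hN1 : (n + 1) * (c + 2) - (2 * n + 2) = (n + 1) * c := by
    have : (n + 1) * (c + 2) = (n + 1) * c + (2 * n + 2) := by ring
    omega
  have hN2 : n * (c + 2) - (2 * n + 2) = n * c - 2 := by
    have : n * (c + 2) = n * c + 2 * n := by ring
    omega
  rw [hN1, hN2]
  simp only [Nat.add_sub_cancel] at hnd
  let σ : Fin (n+1) ⊕ Fin (n+1) ≃ Fin (2*n+2) := finSumFinEquiv.trans (finCongr (by omega))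
  have hsum : ∀ k : Fin (2*n+2) → ℕ,
      ∑ e, k e = ∑ e, (k (σ (Sum.inl e)) + k (σ (Sum.inr e))) := by
    intro k
    rw [← Equiv.sum_comp σ, Fintype.sum_sum_type, Finset.sum_add_distrib]
  have hall : ∀ (k : Fin (2*n+2) → ℕ) (t : ℕ),
      (∀ e, k (σ (Sum.inl e)) ≤ t ∧ k (σ (Sum.inr e)) ≤ t) → ∀ e, k e ≤ t := by
    intro k t h e
    obtain ⟨s, rfl⟩ := σ.surjective e
    rcases s with s | s
    · exact (h s).1
    · exact (h s).2
  let lift : (Fin (n+1) → ℕ) → Fin (2*n+2) → ℕ := fun b e => Sum.elim b 0 (σ.symm e)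
  have hl : ∀ b e, lift b (σ (Sum.inl e)) = b e := by intro b e; simp [lift]
  have hr : ∀ b e, lift b (σ (Sum.inr e)) = 0 := by intro b e; simp [lift]
  have hlift : ∀ b N, b ∈ I (n+1) (c+2) N → lift b ∈ I (2*n+2) (c+2) N := by
    intro b N hb
    rw [aux_mem] at hb ⊢
    refine ⟨hall _ _ fun e => ⟨by rw [hl]; exact hb.1 e, by rw [hr]; omega⟩, ?_⟩
    rw [hsum]
    simp only [hl, hr, add_zero, hb.2]
  have hcomp : ∀ b : Fin (n+1) → ℕ, b ∈ I (n+1) (c+2) (c+2) →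
      (fun e => c - b e) ∈ I (n+1) (c+2) (n*c-2) := by
    intro b hb
    rw [aux_mem] at hb ⊢
    refine ⟨fun e => by simp, ?_⟩
    have h1 : ∑ e, (c - b e) + ∑ e, b e = (n+1)*c := by
      rw [← Finset.sum_add_distrib, Finset.sum_congr rfl (g := fun _ => c)]
      · simp
      · intro e _
        have := hb.1 e
        omega
    have : (n+1)*c = n*c+c := by ring
    have := hb.2
    omega
  refine ⟨fun k => if ∀ e, k (σ (Sum.inl e)) + k (σ (Sum.inr e)) = c then 1 else 0, ?_, ?_, ?_⟩
  · intro k hk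
    beta_reduce
    rw [if_neg]
    intro h
    apply hk
    rw [aux_mem]
    refine ⟨hall _ _ fun e => ?_, ?_⟩
    · have := h e
      omega
    · rw [hsum]
      simp [h]
  · refine ⟨lift fun _ => c, ?_⟩
    simp [hl, hr]
  · rw [← aux_card n (c+2) hd, ← Fintype.card_coe]
    refine aux_rank _
      (Matrix.of fun i b => if ∀ e, i.1 (σ (Sum.inl e)) + i.1 (σ (Sum.inr e)) + b.1 e = c
        then 1 else 0)
      (Matrix.of fun b j => if ∀ e, b.1 e = j.1 (σ (Sum.inl e)) + j.1 (σ (Sum.inr e))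
        then 1 else 0) ?_
      (fun b => ⟨lift (fun e => c - b.1 e), hlift _ _ (hcomp _ b.2)⟩)
      (fun b => ⟨lift b.1, hlift _ _ b.2⟩) ?_
    · ext i j
      simp only [Matrix.of_apply, Matrix.mul_apply, Pi.add_apply]
      split_ifs with h
      · have hb : (fun e => j.1 (σ (Sum.inl e)) + j.1 (σ (Sum.inr e))) ∈ I (n+1) (c+2) (c+2) := by
          rw [aux_mem]
          refine ⟨fun e => by have := h e; simp; omega, ?_⟩
          rw [← hsum]
          exact ((aux_mem _ _ _ _).1 j.2).2
        rw [Finset.sum_eq_single ⟨_, hb⟩]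
        · rw [if_pos, if_pos]
          · simp
          · intro e; rfl
          · intro e; have := h e; simp only; omega
        · intro b _ hne
          rw [if_neg (c := ∀ e, b.1 e = _), mul_zero]
          intro h'
          exact hne (Subtype.ext (funext h'))
        · simp
      · symm
        apply Finset.sum_eq_zero
        intro b _
        by_contra hc
        simp only [mul_ite, mul_one, mul_zero] at hc
        split_ifs at hc with h1 h2
        · apply h
          intro e
          have := h1 e
          have := h2 e
          omega
        all_goals simp at hc
    · intro b b'
      simp only [Matrix.of_apply, Pi.add_apply, hl, hr]
      congr 1
      rw [eq_iff_iff]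
      constructor
      · intro h
        apply Subtype.ext
        ext e
        have := h e
        have := ((aux_mem _ _ _ _).1 b.2).1 e
        omega
      · rintro rfl e
        have := ((aux_mem _ _ _ _).1 b.2).1 e
        omega
end

section
/- Let n ≥ 1 and d ≥ 3 be integers with n(d−2) ≥ 2, and fix the lexicographic order on ℕ^{2n+2}. Let x : ℕ^{2n+2} → ℂ be supported on I_{(n+1)d−(2n+2)}, and suppose k ∈ I_{(n+1)d−(2n+2)} satisfies x_k ≠ 0 and x_{k'} = 0 for every k' lexicographically greater than k. Then the matrix M(x), with rows indexed by I_{nd−(2n+2)}, columns indexed by I_d, and (i,j)-entry x_{i+j}, has rank at least #{(i,j) ∈ I_{nd−(2n+2)} × I_d : i + j = k}. -/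
open Finset

theorem det_tri {ι L : Type*} [Fintype ι] [DecidableEq ι] [LinearOrder L] (N : Matrix ι ι ℂ)
    (f : ι → L) (hf : Function.Injective f) (h : ∀ p q, f q < f p → N p q = 0) :
    N.det = ∏ i, N i i := by
  let _ : LinearOrder ι := LinearOrder.lift' f hf
  have ht : N.IsUpperTriangular := by
    intro p q hqp
    exact h p q hqp
  have e := Matrix.det_of_isUpperTriangular ht
  convert e

theorem stmt5 (n d : ℕ) (hn : 1 ≤ n) (hd : 3 ≤ d) (hnd : 2 ≤ n * (d - 2))
    (x : (Fin (2 * n + 2) → ℕ) → ℂ)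
    (hsupp : ∀ i, i ∉ I (2 * n + 2) d ((n + 1) * d - (2 * n + 2)) → x i = 0)
    (k : Fin (2 * n + 2) → ℕ) (hk : k ∈ I (2 * n + 2) d ((n + 1) * d - (2 * n + 2)))
    (hxk : x k ≠ 0)
    (hmax : ∀ k' : Fin (2 * n + 2) → ℕ, toLex k < toLex k' → x k' = 0) :
    (((I (2 * n + 2) d (n * d - (2 * n + 2))) ×ˢ (I (2 * n + 2) d d)).filter
        fun p => p.1 + p.2 = k).card ≤
      (Matrix.of fun (i : I (2 * n + 2) d (n * d - (2 * n + 2)))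
        (j : I (2 * n + 2) d d) => x (i.1 + j.1)).rank := by
  set S := ((I (2 * n + 2) d (n * d - (2 * n + 2))) ×ˢ (I (2 * n + 2) d d)).filter
        fun p => p.1 + p.2 = k with hS
  have h1 : ∀ p : S, p.1.1 ∈ I (2 * n + 2) d (n * d - (2 * n + 2)) := fun p =>
    (Finset.mem_product.1 (Finset.mem_filter.1 p.2).1).1
  have h2 : ∀ p : S, p.1.2 ∈ I (2 * n + 2) d d := fun p =>
    (Finset.mem_product.1 (Finset.mem_filter.1 p.2).1).2
  have h3 : ∀ p : S, p.1.1 + p.1.2 = k := fun p => (Finset.mem_filter.1 p.2).2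
  set M := (Matrix.of fun (i : I (2 * n + 2) d (n * d - (2 * n + 2)))
        (j : I (2 * n + 2) d d) => x (i.1 + j.1)) with hM
  let N : Matrix S S ℂ := M.submatrix (fun p => ⟨p.1.1, h1 p⟩) (fun p => ⟨p.1.2, h2 p⟩)
  have hN : ∀ p q : S, N p q = x (p.1.1 + q.1.2) := fun p q => rfl
  have hinj : Function.Injective (fun p : S => toLex p.1.1) := by
    intro p q h
    have h' : p.1.1 = q.1.1 := toLex.injective h
    have := (h3 p).trans (h3 q).symm
    rw [h'] at this
    exact Subtype.ext (Prod.ext h' (add_left_cancel this))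
  have hdet : N.det ≠ 0 := by
    have e' := det_tri N (fun p : S => toLex p.1.1) hinj (by
      intro p q hlt
      rw [hN]
      apply hmax
      rw [← h3 q]
      exact add_lt_add_left hlt (toLex q.1.2))
    rw [e', Finset.prod_ne_zero_iff]
    intro p _
    rw [hN, h3]
    exact hxk
  have hr : N.rank = S.card := by
    rw [Matrix.rank_of_isUnit N ((Matrix.isUnit_iff_isUnit_det N).2 (isUnit_iff_ne_zero.2 hdet))]
    simp
  rw [← hr]
  exact Matrix.rank_submatrix_le M _ _
end

section
/- Let a, b, r be natural numbers with a ≤ r and 1 ≤ b ≤ a·r. Then the set S := {s ∈ ℕ : s ≤ a and b ≤ (a−s)(r−s)} is nonempty, and its maximum equals a − ⌈ √( ((r−a)/2)² + b ) − (r−a)/2 ⌉, where ⌈·⌉ denotes the ceiling of a real number and √ denotes the real square root. -/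
theorem stmt6 (a b r : ℕ) (har : a ≤ r) (hb : 1 ≤ b) (hbar : b ≤ a * r) :
    ∃ smax : ℕ,
      IsGreatest {s : ℕ | s ≤ a ∧ (b : ℤ) ≤ ((a : ℤ) - s) * ((r : ℤ) - s)} smax ∧
      (smax : ℤ) =
        (a : ℤ) - ⌈Real.sqrt ((((r : ℝ) - a) / 2) ^ 2 + b) - ((r : ℝ) - a) / 2⌉ := by
  have hd : (0 : ℝ) ≤ (r : ℝ) - a := by
    have : (a : ℝ) ≤ r := by exact_mod_cast har
    linarith
  have key : ∀ t : ℤ, 0 ≤ t →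
      (⌈Real.sqrt ((((r : ℝ) - a) / 2) ^ 2 + b) - ((r : ℝ) - a) / 2⌉ ≤ t ↔
        (b : ℤ) ≤ t * (t + (r - a))) := by
    intro t ht
    have ht' : (0 : ℝ) ≤ t := by exact_mod_cast ht
    rw [Int.ceil_le, sub_le_iff_le_add, Real.sqrt_le_left (by linarith)]
    have : ((b : ℤ) ≤ t * (t + (r - a))) ↔ ((b : ℝ) ≤ t * (t + (r - a))) := by
      exact_mod_cast Iff.rfl
    rw [this]
    constructor <;> intro h <;> nlinarith
  have h0 : 0 ≤ ⌈Real.sqrt ((((r : ℝ) - a) / 2) ^ 2 + b) - ((r : ℝ) - a) / 2⌉ := by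
    apply Int.ceil_nonneg
    rw [sub_nonneg]
    apply Real.le_sqrt_of_sq_le
    have : (0 : ℝ) ≤ b := Nat.cast_nonneg b
    linarith
  generalize ⌈Real.sqrt ((((r : ℝ) - a) / 2) ^ 2 + b) - ((r : ℝ) - a) / 2⌉ = c at *
  have hca : c ≤ a := by
    rw [key a (by positivity)]
    have : (b : ℤ) ≤ a * r := by exact_mod_cast hbar
    simpa using this
  obtain ⟨s, hs⟩ := Int.eq_ofNat_of_zero_le (sub_nonneg.2 hca)
  refine ⟨s, ⟨⟨by omega, ?_⟩, ?_⟩, hs.symm⟩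
  · have h := (key c h0).1 le_rfl
    have h1 : (a : ℤ) - s = c := by omega
    have h2 : (r : ℤ) - s = c + (r - a) := by omega
    rw [h1, h2]; exact h
  · rintro u ⟨hu, hbu⟩
    have h := (key (a - u) (by omega)).2 (by
      have h2 : (a : ℤ) - u + (r - a) = r - u := by ring
      rw [h2]; exact hbu)
    omega
end
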